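/- There exist a constant c > 0 and a natural number N such that for all n ≥ N, the Res(⊕) space of the functional pigeonhole principle satisfies Space(FPHP_n^{n+1}) ≥ c·n. -/

import Mathlib

open Finset

/-- The two-element field. -/
abbrev F2 : Type := ZMod 2

/-- An `F2`-linear form in the variables `V`, given by its coefficients. -/
abbrev LinForm (V : Type) : Type := V → F2

/-- A linear literal: an equation `f = a` where `f` is a linear form and `a ∈ F2`. -/
abbrev LinLit (V : Type) : Type := LinForm V × F2

/-- A linear clause: a finite disjunction of linear literals. -/
abbrev LinClause (V : Type) : Type := Finset (LinLit V)

/-- A linear system: a finite conjunction of linear equations. -/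
abbrev LinSystem (V : Type) : Type := Finset (LinLit V)

/-- A linear CNF formula: a conjunction of linear clauses. -/
abbrev LinCNF (V : Type) : Type := Set (LinClause V)

variable {V : Type}

/-- Evaluation of a linear form at an assignment. -/
def evalForm [Fintype V] (f : LinForm V) (σ : V → F2) : F2 := ∑ v, f v * σ v

/-- The assignment `σ` satisfies the linear equation `l.1 = l.2`. -/
def LitSat [Fintype V] (σ : V → F2) (l : LinLit V) : Prop := evalForm l.1 σ = l.2

/-- The assignment `σ` satisfies the linear clause `C` (some literal of `C` holds). -/
def ClauseSat [Fintype V] (σ : V → F2) (C : LinClause V) : Prop := ∃ l ∈ C, LitSat σ l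

/-- The assignment `σ` is a solution of the linear system `S` (all equations hold). -/
def SysSat [Fintype V] (σ : V → F2) (S : LinSystem V) : Prop := ∀ l ∈ S, LitSat σ l

/-- The assignment `σ` satisfies the linear CNF `φ`. -/
def CNFSat [Fintype V] (σ : V → F2) (φ : LinCNF V) : Prop := ∀ C ∈ φ, ClauseSat σ C

/-- The linear CNF `φ` is unsatisfiable. -/
def Unsat [Fintype V] (φ : LinCNF V) : Prop := ¬ ∃ σ, CNFSat σ φ

/-- The positive literal `v = 1` for a single variable `v`. -/
def posLit [DecidableEq V] (v : V) : LinLit V := (Pi.single v 1, 1)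

/-- The negative literal `v = 0` for a single variable `v`. -/
def negLit [DecidableEq V] (v : V) : LinLit V := (Pi.single v 1, 0)

/-- A solution is `F`-proper if it satisfies every clause of `F`. -/
def FProper [Fintype V] (F : Set (LinClause V)) (σ : V → F2) : Prop := ∀ C ∈ F, ClauseSat σ C

/-- `φ` is `m`-extensible w.r.t. `F`: every linear system with fewer than `m` equations
that has an `F`-proper solution has, for each clause `C ∈ φ \ F`, an `F`-proper solution
satisfying `C`. -/
def Extensible [Fintype V] (φ : LinCNF V) (F : Set (LinClause V)) (m : ℕ) : Prop :=
  ∀ S : LinSystem V, S.card < m → (∃ σ, SysSat σ S ∧ FProper F σ) →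
    ∀ C ∈ φ \ F, ∃ τ, SysSat τ S ∧ FProper F τ ∧ ClauseSat τ C

/-- A configuration: a finite set of linear clauses kept in memory. -/
abbrev Config (V : Type) : Type := Finset (LinClause V)

/-- Semantic inference: `C` follows from clauses in `S` by the resolution rule or the
semantic weakening rule. -/
def InferSem [Fintype V] [DecidableEq V] (S : Config V) (C : LinClause V) : Prop :=
  (∃ (f : LinForm V) (A B : LinClause V),
      insert (f, (0 : F2)) A ∈ S ∧ insert (f, (1 : F2)) B ∈ S ∧ C = A ∪ B) ∨
  (∃ D ∈ S, ∀ σ, ClauseSat σ D → ClauseSat σ C)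

/-- The identically zero linear form. -/
def zeroForm (V : Type) : LinForm V := fun _ => 0

/-- Syntactic inference: `C` follows from clauses in `S` by the resolution rule,
the simplification rule, the syntactic weakening rule, or the addition rule. -/
def InferSyn [Fintype V] [DecidableEq V] (S : Config V) (C : LinClause V) : Prop :=
  (∃ (f : LinForm V) (A B : LinClause V),
      insert (f, (0 : F2)) A ∈ S ∧ insert (f, (1 : F2)) B ∈ S ∧ C = A ∪ B) ∨
  (insert ((zeroForm V, (1 : F2)) : LinLit V) C ∈ S) ∨
  (∃ (D : LinClause V) (f : LinForm V) (α : F2), D ∈ S ∧ C = insert (f, α) D) ∨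
  (∃ (D : LinClause V) (f₁ f₂ : LinForm V) (α₁ α₂ : F2),
      insert (f₁, α₁) (insert (f₂, α₂) D) ∈ S ∧
      C = insert (f₁, α₁) (insert (f₁ + f₂, α₁ + α₂ + 1) D))

/-- One step of a configuration-style refutation: download a clause of `φ`,
erase a clause, or add a clause inferred (via `Inf`) from the current configuration. -/
inductive ConfigStep [Fintype V] [DecidableEq V] (φ : LinCNF V)
    (Inf : Config V → LinClause V → Prop) : Config V → Config V → Prop
  | download {S : Config V} {C : LinClause V} (h : C ∈ φ) : ConfigStep φ Inf S (insert C S)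
  | erase {S : Config V} {C : LinClause V} (h : C ∈ S) : ConfigStep φ Inf S (S.erase C)
  | infer {S : Config V} {C : LinClause V} (h : Inf S C) : ConfigStep φ Inf S (insert C S)

/-- A configuration-style Res(⊕) refutation of `φ` with inference rules `Inf`:
a sequence of configurations starting from the empty configuration, each obtained from
the previous one by a basic step, ending with a configuration containing the empty
clause. -/
def IsConfigRefutation [Fintype V] [DecidableEq V] (φ : LinCNF V)
    (Inf : Config V → LinClause V → Prop) (π : List (Config V)) : Prop :=
  π.head? = some (∅ : Config V) ∧ List.Chain' (ConfigStep φ Inf) π ∧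
    ∃ S : Config V, π.getLast? = some S ∧ (∅ : LinClause V) ∈ S

/-- The space of a sequence of configurations: the maximum number of clauses in memory. -/
def spaceOf (π : List (Config V)) : ℕ := (π.map Finset.card).foldr max 0

/-- An assignment to the variables `p_{ij}` is HOLES-proper if it satisfies every hole
axiom, i.e. no hole receives two distinct pigeons. -/
def HolesProper {m n : ℕ} (σ : Fin m × Fin n → F2) : Prop :=
  ∀ i i' : Fin m, ∀ k : Fin n, i ≠ i' → ¬(σ (i, k) = 1 ∧ σ (i', k) = 1)

/-- The pigeon axiom `P_i = ⋁_{j ∈ [n]} p_{ij}`. -/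
def pigeonClause {m n : ℕ} (i : Fin m) : LinClause (Fin m × Fin n) :=
  Finset.univ.image fun j : Fin n => posLit (i, j)

/-- The hole axiom `H_{i i' k} = ¬p_{ik} ∨ ¬p_{i'k}`. -/
def holeClause {m n : ℕ} (i i' : Fin m) (k : Fin n) : LinClause (Fin m × Fin n) :=
  {negLit (i, k), negLit (i', k)}

/-- The pigeonhole principle `PHP_n^m` as a linear CNF. -/
def PHPCNF (m n : ℕ) : LinCNF (Fin m × Fin n) :=
  {C | ∃ i : Fin m, C = pigeonClause i} ∪
  {C | ∃ (i i' : Fin m) (k : Fin n), i ≠ i' ∧ C = holeClause i i' k}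

/-- The functional pigeonhole principle `FPHP_n^{n+1}` as a linear CNF: pigeon axioms,
hole axioms, and functionality axioms. -/
def FPHPCNF (n : ℕ) : LinCNF (Fin (n + 1) × Fin n) :=
  {C | ∃ i : Fin (n + 1), C = pigeonClause i} ∪
  {C | ∃ (i i' : Fin (n + 1)) (k : Fin n), i ≠ i' ∧ C = holeClause i i' k} ∪
  {C | ∃ (i : Fin (n + 1)) (j k : Fin n), j ≠ k ∧
        C = ({negLit (i, j), negLit (i, k)} : LinClause (Fin (n + 1) × Fin n))}

/-! ### Chains of injective partial maps -/

section Chains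

set_option linter.unusedSectionVars false

variable {P H R : Type} [Fintype P] [DecidableEq P] [Fintype H] [DecidableEq H] [CommRing R]

/-- The domain of a partial map. -/
def pdom (a : P → Option H) : Finset P := univ.filter fun i => a i ≠ none

lemma mem_pdom {a : P → Option H} {i : P} : i ∈ pdom a ↔ a i ≠ none := by simp [pdom]

lemma pdom_update_some (a : P → Option H) (i : P) (h : H) :
    pdom (Function.update a i (some h)) = insert i (pdom a) := by
  ext j
  by_cases hj : j = i <;> simp [mem_pdom, hj]

/-- Injectivity of a partial map on its domain. -/
def PInj (a : P → Option H) : Prop := ∀ i j h, a i = some h → a j = some h → i = j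

/-- The marginal of a function on partial maps obtained by forgetting the value at `i`. -/
def marg (i : P) : ((P → Option H) → R) →ₗ[R] ((P → Option H) → R) where
  toFun ζ b := if b i = none then ∑ h, ζ (Function.update b i (some h)) else 0
  map_add' ζ η := by ext b; by_cases hb : b i = none <;> simp [hb, sum_add_distrib]
  map_smul' r ζ := by ext b; by_cases hb : b i = none <;> simp [hb, mul_sum]

/-- Extending all partial maps by `k ↦ c`. -/
def extendAt (k : P) (c : H) : ((P → Option H) → R) →ₗ[R] ((P → Option H) → R) where
  toFun ζ b := if b k = some c then ζ (Function.update b k none) else 0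
  map_add' ζ η := by ext b; by_cases hb : b k = some c <;> simp [hb]
  map_smul' r ζ := by ext b; by_cases hb : b k = some c <;> simp [hb]

/-- The part of a function on partial maps where `k ↦ c`, with the value at `k` removed. -/
def linkAt (k : P) (c : H) (ζ : (P → Option H) → R) : (P → Option H) → R :=
  fun a => if a k = none then ζ (Function.update a k (some c)) else 0

/-- Functions supported on injective partial maps with domain `K` and values in `W`. -/
def chains (R : Type) [CommRing R] (K : Finset P) (W : Finset H) :
    Submodule R ((P → Option H) → R) where
  carrier := {ζ | ∀ b, ζ b ≠ 0 → pdom b = K ∧ (∀ i h, b i = some h → h ∈ W) ∧ PInj b}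
  add_mem' {ζ η} hζ hη b hb := by
    by_cases h : ζ b = 0
    · exact hη b fun h' => hb (by simp [h, h'])
    · exact hζ b h
  zero_mem' b hb := by simp at hb
  smul_mem' r ζ hζ b hb := hζ b fun h => hb (by simp [h])

lemma marg_apply (i : P) (ζ : (P → Option H) → R) (b : P → Option H) :
    marg i ζ b = if b i = none then ∑ h, ζ (Function.update b i (some h)) else 0 := rfl

lemma extendAt_apply (k : P) (c : H) (ζ : (P → Option H) → R) (b : P → Option H) :
    extendAt k c ζ b = if b k = some c then ζ (Function.update b k none) else 0 := rfl

lemma chains_mono {K : Finset P} {W W' : Finset H} (h : W ⊆ W') :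
    chains R K W ≤ chains R K W' := fun _ hζ b hb =>
  ⟨(hζ b hb).1, fun i x hx => h ((hζ b hb).2.1 i x hx), (hζ b hb).2.2⟩

lemma marg_comm (i j : P) (ζ : (P → Option H) → R) :
    marg i (marg j ζ) = marg j (marg i ζ) := by
  by_cases hij : i = j
  · rw [hij]
  ext b
  simp only [marg_apply, Function.update_of_ne hij, Function.update_of_ne (Ne.symm hij)]
  by_cases hi : b i = none <;> by_cases hj : b j = none <;> simp [hi, hj]
  rw [sum_comm]
  simp only [Function.update_comm hij]

lemma marg_extendAt_of_ne {j k : P} (hjk : j ≠ k) (c : H) (ζ : (P → Option H) → R) :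
    marg j (extendAt k c ζ) = extendAt k c (marg j ζ) := by
  ext b
  simp only [marg_apply, extendAt_apply, Function.update_of_ne hjk,
    Function.update_of_ne (Ne.symm hjk)]
  by_cases hj : b j = none <;> by_cases hk : b k = some c <;> simp [hj, hk]
  simp only [Function.update_comm hjk]

lemma marg_linkAt_of_ne {j k : P} (hjk : j ≠ k) (c : H) (ζ : (P → Option H) → R) :
    marg j (linkAt k c ζ) = linkAt k c (marg j ζ) := by
  ext b
  simp only [marg_apply, linkAt, Function.update_of_ne hjk,
    Function.update_of_ne (Ne.symm hjk)]
  by_cases hj : b j = none <;> by_cases hk : b k = none <;> simp [hj, hk]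
  simp only [Function.update_comm hjk]

lemma marg_extendAt_self {k : P} {c : H} {K : Finset P} {W : Finset H} (hk : k ∉ K)
    {ζ : (P → Option H) → R} (hζ : ζ ∈ chains R K W) : marg k (extendAt k c ζ) = ζ := by
  ext b
  simp only [marg_apply, extendAt_apply]
  by_cases hb : b k = none
  · simp [hb]
    congr 1
    rw [← hb, Function.update_eq_self]
  · simp only [hb, if_false]
    by_contra h
    exact hk ((hζ b (Ne.symm h)).1 ▸ mem_pdom.2 hb)

lemma marg_mem {i : P} {K : Finset P} {W : Finset H} (hi : i ∉ K)
    {ζ : (P → Option H) → R} (hζ : ζ ∈ chains R (insert i K) W) :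
    marg i ζ ∈ chains R K W := by
  intro b hb
  rw [marg_apply] at hb
  have hbi : b i = none := by by_contra h; simp [h] at hb
  rw [if_pos hbi] at hb
  obtain ⟨h, -, hh⟩ := exists_ne_zero_of_sum_ne_zero hb
  obtain ⟨h1, h2, h3⟩ := hζ _ hh
  have key : ∀ j x, b j = some x → Function.update b i (some h) j = some x := by
    intro j x hx
    rw [Function.update_of_ne, hx]
    rintro rfl
    simp [hbi] at hx
  refine ⟨?_, fun j x hx => h2 j x (key j x hx),
    fun j j' x hx hx' => h3 j j' x (key j x hx) (key j' x hx')⟩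
  rw [pdom_update_some] at h1
  have hi' : i ∉ pdom b := by simp [mem_pdom, hbi]
  rw [← erase_insert hi', h1, erase_insert hi]

lemma extendAt_mem {k : P} {c : H} {K : Finset P} {W : Finset H} (hc : c ∉ W)
    {ζ : (P → Option H) → R} (hζ : ζ ∈ chains R K W) :
    extendAt k c ζ ∈ chains R (insert k K) (insert c W) := by
  intro b hb
  rw [extendAt_apply] at hb
  have hbk : b k = some c := by by_contra h; simp [h] at hb
  rw [if_pos hbk] at hb
  obtain ⟨h1, h2, h3⟩ := hζ _ hb
  have hb' : b = Function.update (Function.update b k none) k (some c) := by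
    simp [← hbk]
  have key : ∀ j x, j ≠ k → b j = some x → Function.update b k none j = some x := by
    intro j x hj hx
    rw [Function.update_of_ne hj, hx]
  refine ⟨by rw [hb', pdom_update_some, h1], fun j x hx => ?_, fun j j' x hx hx' => ?_⟩
  · by_cases hj : j = k
    · subst hj
      rw [hbk] at hx
      simp [Option.some.inj hx]
    · exact mem_insert_of_mem (h2 j x (key j x hj hx))
  · by_cases hj : j = k <;> by_cases hj' : j' = k
    · rw [hj, hj']
    · subst hj
      rw [hbk] at hx
      exact absurd (h2 j' x (key j' x hj' hx')) (by rwa [← Option.some.inj hx])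
    · subst hj'
      rw [hbk] at hx'
      exact absurd (h2 j x (key j x hj hx)) (by rwa [← Option.some.inj hx'])
    · exact h3 j j' x (key j x hj hx) (key j' x hj' hx')

lemma linkAt_mem {k : P} {c : H} {K : Finset P} {W : Finset H}
    {ζ : (P → Option H) → R} (hζ : ζ ∈ chains R K (insert c W)) :
    linkAt k c ζ ∈ chains R (K.erase k) W := by
  intro b hb
  have hbk : b k = none := by by_contra h; simp [linkAt, h] at hb
  simp only [linkAt, if_pos hbk] at hb
  obtain ⟨h1, h2, h3⟩ := hζ _ hb
  have hne : ∀ j x, b j = some x → j ≠ k := by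
    rintro j x hx rfl
    simp [hbk] at hx
  have key : ∀ j x, b j = some x → Function.update b k (some c) j = some x := fun j x hx => by
    rw [Function.update_of_ne (hne j x hx), hx]
  refine ⟨?_, fun j x hx => ?_, fun j j' x hx hx' => h3 j j' x (key j x hx) (key j' x hx')⟩
  · rw [← h1, pdom_update_some, erase_insert]
    simp [mem_pdom, hbk]
  · refine (mem_insert.1 (h2 j x (key j x hx))).resolve_left ?_
    rintro rfl
    exact hne j x hx (h3 j k x (key j x hx) (by simp))

lemma extendAt_linkAt {k : P} {c : H} {ζ : (P → Option H) → R} {b : P → Option H}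
    (hb : b k = some c) : extendAt k c (linkAt k c ζ) b = ζ b := by
  rw [extendAt_apply, if_pos hb, linkAt, if_pos (Function.update_self ..), Function.update_idem,
    ← hb, Function.update_eq_self]

lemma eq_zero_of_value_notMem {K : Finset P} {W : Finset H} {ζ : (P → Option H) → R}
    (hζ : ζ ∈ chains R K W) {b : P → Option H} {k : P} {c : H} (hb : b k = some c) (hc : c ∉ W) :
    ζ b = 0 := by
  by_contra h
  exact hc ((hζ b h).2.1 k c hb)

lemma extendAt_eq_zero {K : Finset P} {W : Finset H} {ζ : (P → Option H) → R}
    (hζ : ζ ∈ chains R K W) {b : P → Option H} {k k' : P} {c : H} (hc : c ∉ W) (hk : k' ≠ k)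
    (hb : b k' = some c) : extendAt k c ζ b = 0 := by
  by_contra h
  have hbk : b k = some c := by by_contra h'; simp [extendAt_apply, h'] at h
  exact hk ((extendAt_mem hc hζ b h).2.2 k' k c hb hbk)

/-- Chains with vanishing marginals along `S` lift to one more point with vanishing marginals
along `S`, as long as there are enough values. -/
theorem exists_marg_eq (W : Finset H) : ∀ (K S : Finset P) (i : P), i ∉ K → S ⊆ K →
    K.card + 1 + S.card ≤ W.card → ∀ ζ ∈ chains R K W, (∀ j ∈ S, marg j ζ = 0) →
    ∃ ξ ∈ chains R (insert i K) W, marg i ξ = ζ ∧ ∀ j ∈ S, marg j ξ = 0 := by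
  induction W using Finset.induction_on with
  | empty => intro K S i _ _ h; simp at h
  | insert c W hc ih =>
    intro K S i hi hSK hcard ζ hζ hζS
    rw [card_insert_of_notMem hc] at hcard
    have main : ∀ k ∈ K, ∃ N ∈ chains R (insert i K) (insert c W), (∀ j ∈ S, marg j N = 0) ∧
        (∀ b : P → Option H, b k = some c → marg i N b = ζ b) ∧
        ∀ b k', k' ≠ k → b k' = some c → marg i N b = 0 := by
      intro k hk
      have hik : i ≠ k := by rintro rfl; exact hi hk
      have hl := linkAt_mem (k := k) hζ
      have hKk : (K.erase k).card + 1 = K.card := card_erase_add_one hk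
      have hins : insert k (insert i (K.erase k)) = insert i K := by
        rw [Finset.insert_comm, insert_erase hk]
      have hlS : ∀ j ∈ S, j ≠ k → marg j (linkAt k c ζ) = 0 := fun j hj hjk => by
        rw [marg_linkAt_of_ne hjk, hζS j hj]
        ext b
        simp [linkAt]
      by_cases hkS : k ∈ S
      · have hSk : (S.erase k).card + 1 = S.card := card_erase_add_one hkS
        obtain ⟨μ, hμ, hμk, hμS⟩ := ih (K.erase k) (S.erase k) k (notMem_erase k K)
          (erase_subset_erase k hSK) (by omega) _ hl
          (fun j hj => hlS j (mem_of_mem_erase hj) (ne_of_mem_erase hj))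
        rw [insert_erase hk] at hμ
        obtain ⟨M, hM, hMi, hMS⟩ := ih K (S.erase k) i hi ((erase_subset k S).trans hSK)
          (by omega) μ hμ hμS
        have hkM : marg k M ∈ chains R (insert i (K.erase k)) W :=
          marg_mem (by simp [hik.symm]) (by rwa [hins])
        have hiN : marg i (extendAt k c (marg k M) - M) =
            extendAt k c (linkAt k c ζ) - μ := by
          rw [map_sub, marg_extendAt_of_ne hik, marg_comm, hMi, hμk]
        refine ⟨extendAt k c (marg k M) - M, ?_, ?_, ?_, ?_⟩
        · refine Submodule.sub_mem _ ?_ (chains_mono (subset_insert c W) hM)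
          rw [← hins]
          exact extendAt_mem hc hkM
        · intro j hj
          by_cases hjk : j = k
          · subst hjk
            rw [map_sub, marg_extendAt_self (by simp [hik.symm]) hkM, sub_self]
          · have := hMS j (mem_erase.2 ⟨hjk, hj⟩)
            rw [map_sub, marg_extendAt_of_ne hjk, marg_comm, this, map_zero, map_zero, sub_zero]
        · intro b hb
          rw [hiN, Pi.sub_apply, extendAt_linkAt hb, eq_zero_of_value_notMem hμ hb hc, sub_zero]
        · intro b k' hk' hb
          rw [hiN, Pi.sub_apply, extendAt_eq_zero hl hc hk' hb,
            eq_zero_of_value_notMem hμ hb hc, sub_zero]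
      · have hne : ∀ j ∈ S, j ≠ k := fun j hj h => hkS (h ▸ hj)
        obtain ⟨μ, hμ, hμi, hμS⟩ := ih (K.erase k) S i (fun h => hi (mem_of_mem_erase h))
          (fun j hj => mem_erase.2 ⟨hne j hj, hSK hj⟩) (by omega) _ hl
          (fun j hj => hlS j hj (hne j hj))
        have hiN : marg i (extendAt k c μ) = extendAt k c (linkAt k c ζ) := by
          rw [marg_extendAt_of_ne hik, hμi]
        refine ⟨extendAt k c μ, ?_, fun j hj => ?_, fun b hb => ?_, fun b k' hk' hb => ?_⟩
        · rw [← hins]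
          exact extendAt_mem hc hμ
        · rw [marg_extendAt_of_ne (hne j hj), hμS j hj, map_zero]
        · rw [hiN, extendAt_linkAt hb]
        · rw [hiN, extendAt_eq_zero hl hc hk' hb]
    choose! N hN hNS hN1 hN2 using main
    have hη : ζ - ∑ k ∈ K, marg i (N k) ∈ chains R K W := by
      intro b hb
      obtain ⟨h1, h2, h3⟩ := Submodule.sub_mem _ hζ
        (Submodule.sum_mem _ fun k hk => marg_mem hi (hN k hk)) b hb
      refine ⟨h1, fun k x hx => (mem_insert.1 (h2 k x hx)).resolve_left ?_, h3⟩
      rintro rfl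
      have hk : k ∈ K := h1 ▸ mem_pdom.2 (by simp [hx])
      apply hb
      rw [Pi.sub_apply, Finset.sum_apply, sum_eq_single_of_mem k hk, hN1 k hk b hx, sub_self]
      exact fun k' hk' hne => hN2 k' hk' b k hne.symm hx
    refine ⟨extendAt i c (ζ - ∑ k ∈ K, marg i (N k)) + ∑ k ∈ K, N k,
      Submodule.add_mem _ (extendAt_mem hc hη) (Submodule.sum_mem _ hN), ?_, ?_⟩
    · rw [map_add, marg_extendAt_self hi hη, map_sum, sub_add_cancel]
    · intro j hj
      have hji : j ≠ i := by rintro rfl; exact hi (hSK hj)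
      have h0 : ∀ k ∈ K, marg j (marg i (N k)) = 0 := fun k hk => by
        rw [marg_comm, hNS k hk j hj, map_zero]
      rw [map_add, marg_extendAt_of_ne hji, map_sub, map_sum, map_sum, sum_eq_zero h0,
        hζS j hj, sub_zero, map_zero, zero_add, sum_eq_zero fun k hk => hNS k hk j hj]

/-- A compatible family of chains on the proper subsets of `K` extends to `K`. -/
theorem exists_chain_of_compatible (K : Finset P) (hK : 2 * K.card ≤ Fintype.card H + 1)
    (ξ : (P → Option H) → R) (hinj : ∀ b, ξ b ≠ 0 → PInj b)
    (hξ : ∀ b, ∀ i ∉ pdom b, (pdom b).card + 1 < K.card →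
      ∑ h, ξ (Function.update b i (some h)) = ξ b) :
    ∃ θ ∈ chains R K (univ : Finset H), ∀ b, ∀ i ∉ pdom b, insert i (pdom b) = K →
      ∑ h, θ (Function.update b i (some h)) = ξ b := by
  let F : Finset P → (P → Option H) → R := fun J b => if pdom b = J then ξ b else 0
  have hF : ∀ J, F J ∈ chains R J (univ : Finset H) := by
    intro J b hb
    by_cases h : pdom b = J
    · exact ⟨h, by simp, hinj b (by simpa [F, h] using hb)⟩
    · simp [F, h] at hb
  have hmF : ∀ J, ∀ j ∉ J, J.card + 1 < K.card → marg j (F (insert j J)) = F J := by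
    intro J j hj hJ
    ext b
    by_cases hb : b j = none
    · have hb' : j ∉ pdom b := by simp [mem_pdom, hb]
      have hiff : insert j (pdom b) = insert j J ↔ pdom b = J :=
        ⟨fun h => by rw [← erase_insert hb', h, erase_insert hj], fun h => by rw [h]⟩
      simp only [marg_apply, hb, F, pdom_update_some, hiff, if_true]
      split_ifs with h
      · exact hξ b j hb' (by rwa [h])
      · simp
    · have : pdom b ≠ J := by rintro rfl; exact hj (mem_pdom.2 hb)
      simp [marg_apply, hb, F, this]
  have main : ∀ T ⊆ K, ∃ θ ∈ chains R K (univ : Finset H), ∀ j ∈ T,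
      marg j θ = F (K.erase j) := by
    intro T
    induction T using Finset.induction_on with
    | empty => exact fun _ => ⟨0, Submodule.zero_mem _, by simp⟩
    | insert i T hi ih =>
      intro hT
      obtain ⟨hiK, hTK⟩ := insert_subset_iff.1 hT
      obtain ⟨θ, hθ, hθT⟩ := ih hTK
      have hins : insert i (K.erase i) = K := insert_erase hiK
      have hTi : T ⊆ K.erase i := fun j hj => mem_erase.2 ⟨fun h => hi (h ▸ hj), hTK hj⟩
      have hc1 : (K.erase i).card + 1 = K.card := card_erase_add_one hiK
      have hc2 := card_le_card hTi
      obtain ⟨θ', hθ', hθi, hθ'T⟩ := exists_marg_eq (univ : Finset H) (K.erase i) T i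
        (notMem_erase i K) hTi (by rw [card_univ]; omega) (F (K.erase i) - marg i θ)
        (Submodule.sub_mem _ (hF _) (marg_mem (notMem_erase i K) (by rwa [hins]))) (by
          intro j hj
          have hji : j ≠ i := fun h => hi (h ▸ hj)
          have hc3 : ((K.erase i).erase j).card + 1 = (K.erase i).card :=
            card_erase_add_one (hTi hj)
          have e1 := hmF ((K.erase i).erase j) j (notMem_erase _ _) (by omega)
          have e2 := hmF ((K.erase j).erase i) i (notMem_erase _ _)
            (by rw [erase_right_comm]; omega)
          rw [insert_erase (hTi hj)] at e1
          rw [insert_erase (mem_erase.2 ⟨hji.symm, hiK⟩)] at e2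
          rw [map_sub, marg_comm, hθT j hj, e1, e2, erase_right_comm, sub_self])
      rw [hins] at hθ'
      refine ⟨θ + θ', Submodule.add_mem _ hθ hθ', fun j hj => ?_⟩
      rcases mem_insert.1 hj with rfl | hj
      · rw [map_add, hθi, add_sub_cancel]
      · rw [map_add, hθT j hj, hθ'T j hj, add_zero]
  obtain ⟨θ, hθ, hθK⟩ := main K subset_rfl
  refine ⟨θ, hθ, fun b i hi hb => ?_⟩
  have := congrFun (hθK i (hb ▸ mem_insert_self _ _)) b
  have hbi : b i = none := by simpa [mem_pdom] using hi
  simpa [marg_apply, hbi, F, ← hb, erase_insert hi] using this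

end Chains

/-! ### Pseudo-expectations on partial maps -/

section PseudoExpectation

set_option linter.unusedSectionVars false

variable {P H : Type} [Fintype P] [DecidableEq P] [Fintype H] [DecidableEq H]

/-- The indicator that a partial map sends `v.1` to `v.2`. -/
def pvar (v : P × H) : (P → Option H) → F2 := fun b => if b v.1 = some v.2 then 1 else 0

/-- The indicator that a partial map extends `a`. -/
def mono (a : P → Option H) : (P → Option H) → F2 :=
  fun b => if ∀ i, a i ≠ none → b i = a i then 1 else 0

/-- The span of the indicators `mono a` where `a` has domain of size at most `s`. -/
def degLE (P H : Type) [Fintype P] [DecidableEq P] [Fintype H] [DecidableEq H] (s : ℕ) :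
    Submodule F2 ((P → Option H) → F2) :=
  Submodule.span F2 (mono '' {a | (pdom a).card ≤ s})

lemma mono_mem_degLE {a : P → Option H} {s : ℕ} (h : (pdom a).card ≤ s) :
    mono a ∈ degLE P H s := Submodule.subset_span ⟨a, h, rfl⟩

lemma degLE_mono {s t : ℕ} (h : s ≤ t) : degLE P H s ≤ degLE P H t :=
  Submodule.span_mono (Set.image_mono fun _ ha => le_trans ha h)

lemma one_eq_mono : (1 : (P → Option H) → F2) = mono fun _ => none := by
  ext b; simp [mono]

lemma one_mem_degLE (s : ℕ) : (1 : (P → Option H) → F2) ∈ degLE P H s := by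
  rw [one_eq_mono]
  exact mono_mem_degLE (by simp [pdom])

lemma mono_mul_pvar_of_none {a : P → Option H} {v : P × H} (h : a v.1 = none) :
    mono a * pvar v = mono (Function.update a v.1 (some v.2)) := by
  ext b
  have : (∀ i, Function.update a v.1 (some v.2) i ≠ none →
      b i = Function.update a v.1 (some v.2) i) ↔
      (∀ i, a i ≠ none → b i = a i) ∧ b v.1 = some v.2 := by
    constructor
    · refine fun hb => ⟨fun i hi => ?_, by simpa using hb v.1⟩
      have hiv : i ≠ v.1 := by rintro rfl; exact hi h
      simpa [hiv, hi] using hb i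
    · rintro ⟨hb, hv⟩ i hi
      by_cases hiv : i = v.1
      · subst hiv; simpa using hv
      · simp only [Function.update_of_ne hiv] at hi ⊢
        exact hb i hi
  simp only [Pi.mul_apply, mono, pvar, this]
  split_ifs <;> simp_all

lemma mono_mul_pvar_of_some {a : P → Option H} {v : P × H} {h : H} (ha : a v.1 = some h) :
    mono a * pvar v = if h = v.2 then mono a else 0 := by
  ext b
  by_cases hb : ∀ i, a i ≠ none → b i = a i
  · have := hb v.1 (by simp [ha])
    split_ifs with hh <;> simp [mono, pvar, hb, ha, hh]
  · split_ifs <;> simp [mono, hb]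

lemma mul_pvar_mem {s : ℕ} {f : (P → Option H) → F2} (hf : f ∈ degLE P H s) (v : P × H) :
    f * pvar v ∈ degLE P H (s + 1) := by
  induction hf using Submodule.span_induction with
  | mem x hx =>
    obtain ⟨a, ha, rfl⟩ := hx
    rcases h : a v.1 with _ | j
    · rw [mono_mul_pvar_of_none h]
      refine mono_mem_degLE ?_
      rw [pdom_update_some]
      exact (card_insert_le _ _).trans (Nat.succ_le_succ ha)
    · rw [mono_mul_pvar_of_some h]
      split_ifs
      · exact mono_mem_degLE (le_trans ha (Nat.le_succ s))
      · exact Submodule.zero_mem _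
  | zero => simp
  | add x y _ _ hx hy => rw [add_mul]; exact Submodule.add_mem _ hx hy
  | smul r x _ hx => rw [smul_mul_assoc]; exact Submodule.smul_mem _ _ hx

lemma linearIndependent_mono :
    LinearIndependent F2 (mono : (P → Option H) → (P → Option H) → F2) := by
  rw [Fintype.linearIndependent_iff]
  intro g hg
  suffices ∀ N, ∀ a : P → Option H, (pdom a).card = N → g a = 0 from fun a => this _ a rfl
  intro N
  induction N using Nat.strong_induction_on with
  | _ N ih =>
    intro a ha
    have h := congrFun hg a
    rw [Finset.sum_apply, sum_eq_single a] at h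
    · simpa [mono] using h
    · intro b _ hb
      by_cases hba : ∀ i, b i ≠ none → a i = b i
      · have hlt : pdom b ⊂ pdom a := by
          refine (ssubset_iff_of_subset fun i hi => ?_).2 ?_
          · rw [mem_pdom] at hi ⊢
            rwa [hba i hi]
          · by_contra! hcon
            apply hb
            ext1 i
            by_cases hi : i ∈ pdom b
            · exact (hba i (mem_pdom.1 hi)).symm
            · have h1 : b i = none := by simpa [mem_pdom] using hi
              have h2 : a i = none := by simpa [mem_pdom] using fun h => hi (hcon i h)
              rw [h1, h2]
        rw [Pi.smul_apply, ih _ (ha ▸ card_lt_card hlt) b rfl, zero_smul]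
      · simp [mono, hba]
    · simp

/-- The indicators `mono a` form a basis of all functions on partial maps. -/
noncomputable def monoBasis (P H : Type) [Fintype P] [DecidableEq P] [Fintype H]
    [DecidableEq H] : Module.Basis (P → Option H) F2 ((P → Option H) → F2) :=
  basisOfLinearIndependentOfCardEqFinrank linearIndependent_mono (by simp)

lemma monoBasis_apply (a : P → Option H) : monoBasis P H a = mono a := by
  simp [monoBasis]

/-- A pseudo-expectation of degree `r`: a linear functional that respects all hole axioms, and
the pigeon axioms up to degree `r`. -/
structure IsPseudoExp (r : ℕ) (E : ((P → Option H) → F2) →ₗ[F2] F2) : Prop where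
  hole : ∀ i j h, i ≠ j → ∀ f, E (f * (pvar (i, h) * pvar (j, h))) = 0
  pigeon : ∀ i s, s + 1 ≤ r → ∀ f ∈ degLE P H s, E (f * ∑ h, pvar (i, h)) = E f

lemma IsPseudoExp.pinj {r : ℕ} {E : ((P → Option H) → F2) →ₗ[F2] F2} (hE : IsPseudoExp r E)
    {a : P → Option H} (ha : E (mono a) ≠ 0) : PInj a := by
  intro i j h hi hj
  by_contra hij
  have := hE.hole i j h hij (mono a)
  rw [← mul_assoc, mono_mul_pvar_of_some (v := (i, h)) hi, if_pos rfl,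
    mono_mul_pvar_of_some (v := (j, h)) hj, if_pos rfl] at this
  exact ha this

lemma IsPseudoExp.sum_update {r : ℕ} {E : ((P → Option H) → F2) →ₗ[F2] F2}
    (hE : IsPseudoExp r E) {a : P → Option H} {i : P} (hi : i ∉ pdom a)
    (ha : (pdom a).card + 1 ≤ r) :
    ∑ h, E (mono (Function.update a i (some h))) = E (mono a) := by
  have hai : a i = none := by simpa [mem_pdom] using hi
  rw [← hE.pigeon i _ ha (mono a) (mono_mem_degLE le_rfl), mul_sum, map_sum]
  exact sum_congr rfl fun h _ => by rw [mono_mul_pvar_of_none (v := (i, h)) hai]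

lemma isPseudoExp_of_mono {r : ℕ} {E : ((P → Option H) → F2) →ₗ[F2] F2}
    (hinj : ∀ a, E (mono a) ≠ 0 → PInj a)
    (hsum : ∀ a, ∀ i ∉ pdom a, (pdom a).card + 1 ≤ r →
      ∑ h, E (mono (Function.update a i (some h))) = E (mono a)) : IsPseudoExp r E where
  hole i j h hij f := by
    have key : ∀ (a : P → Option H) (v : P × H), mono a * pvar v = 0 ∨
        ∃ a', mono a * pvar v = mono a' ∧ a' v.1 = some v.2 ∧
          ∀ k, a k ≠ none → a' k = a k := by
      intro a v
      rcases ha : a v.1 with _ | x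
      · refine Or.inr ⟨_, mono_mul_pvar_of_none ha, by simp, fun k hk => ?_⟩
        rw [Function.update_of_ne]
        rintro rfl
        exact hk ha
      · rw [mono_mul_pvar_of_some ha]
        split_ifs with hx
        · exact Or.inr ⟨a, rfl, by rw [ha, hx], fun _ _ => rfl⟩
        · exact Or.inl rfl
    have : E ∘ₗ LinearMap.mulRight F2 (pvar (i, h) * pvar (j, h)) = 0 := by
      refine (monoBasis P H).ext fun a => ?_
      rw [monoBasis_apply]
      simp only [LinearMap.comp_apply, LinearMap.mulRight_apply, LinearMap.zero_apply,
        ← mul_assoc]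
      rcases key a (i, h) with h0 | ⟨a', h1, h2, -⟩
      · rw [h0, zero_mul, map_zero]
      rw [h1]
      rcases key a' (j, h) with h0 | ⟨a'', h1', h2', h3'⟩
      · rw [h0, map_zero]
      rw [h1']
      by_contra hne
      exact hij (hinj a'' hne i j h ((h3' i (by simp [h2])).trans h2) h2')
    exact LinearMap.congr_fun this f
  pigeon i s hs f hf := by
    induction hf using Submodule.span_induction with
    | mem x hx =>
      obtain ⟨a, ha, rfl⟩ := hx
      rw [mul_sum, map_sum]
      rcases hai : a i with _ | x
      · rw [← hsum a i (by simp [mem_pdom, hai]) ((Nat.succ_le_succ ha).trans hs)]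
        exact sum_congr rfl fun h _ => by rw [mono_mul_pvar_of_none (v := (i, h)) hai]
      · rw [sum_eq_single x]
        · rw [mono_mul_pvar_of_some (v := (i, x)) hai, if_pos rfl]
        · intro y _ hy
          rw [mono_mul_pvar_of_some (v := (i, y)) hai, if_neg (Ne.symm hy), map_zero]
        · simp
    | zero => simp
    | add x y _ _ hx hy => rw [add_mul, map_add, map_add, hx, hy]
    | smul r x _ hx => rw [smul_mul_assoc, map_smul, map_smul, hx]

/-- A pseudo-expectation of small degree extends to a degree one higher. -/
theorem IsPseudoExp.exists_succ {r : ℕ} {E : ((P → Option H) → F2) →ₗ[F2] F2}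
    (hE : IsPseudoExp r E) (hr : 2 * r + 1 ≤ Fintype.card H) :
    ∃ E', IsPseudoExp (r + 1) E' ∧ ∀ f ∈ degLE P H r, E' f = E f := by
  have hθ : ∀ K : Finset P, ∃ θ ∈ chains F2 K (univ : Finset H), K.card = r + 1 →
      ∀ b, ∀ i ∉ pdom b, insert i (pdom b) = K →
        ∑ h, θ (Function.update b i (some h)) = E (mono b) := by
    intro K
    by_cases hK : K.card = r + 1
    · obtain ⟨θ, h1, h2⟩ := exists_chain_of_compatible K (by omega) (fun b => E (mono b))
        (fun _ => hE.pinj) (fun b i hi hb => hE.sum_update hi (by omega))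
      exact ⟨θ, h1, fun _ => h2⟩
    · exact ⟨0, Submodule.zero_mem _, fun h => absurd h hK⟩
  choose θ hθc hθ using hθ
  let ξ : (P → Option H) → F2 := fun a =>
    if (pdom a).card ≤ r then E (mono a) else θ (pdom a) a
  let E' := (monoBasis P H).constr F2 ξ
  have hE' : ∀ a, E' (mono a) = ξ a := fun a => by
    rw [← monoBasis_apply, Module.Basis.constr_basis]
  refine ⟨E', isPseudoExp_of_mono (fun a ha => ?_) (fun a i hi ha => ?_), fun f hf => ?_⟩
  · rw [hE'] at ha
    by_cases h : (pdom a).card ≤ r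
    · exact hE.pinj (by simpa [ξ, h] using ha)
    · exact (hθc (pdom a) a (by simpa [ξ, h] using ha)).2.2
  · simp only [hE', ξ, pdom_update_some, card_insert_of_notMem hi]
    rw [if_pos (by omega)]
    by_cases h : (pdom a).card + 1 ≤ r
    · simp only [h, if_true]
      exact hE.sum_update hi h
    · simp only [h, if_false]
      exact hθ _ (by rw [card_insert_of_notMem hi]; omega) a i hi rfl
  · induction hf using Submodule.span_induction with
    | mem x hx =>
      obtain ⟨a, ha, rfl⟩ := hx
      rw [hE']
      exact if_pos ha
    | zero => simp
    | add x y _ _ hx hy => rw [map_add, map_add, hx, hy]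
    | smul r x _ hx => rw [map_smul, map_smul, hx]

theorem IsPseudoExp.exists_extension {r t : ℕ} {E : ((P → Option H) → F2) →ₗ[F2] F2}
    (hE : IsPseudoExp r E) (hrt : r ≤ t) (ht : 2 * t ≤ Fintype.card H + 1) :
    ∃ E', IsPseudoExp t E' ∧ ∀ f ∈ degLE P H r, E' f = E f := by
  induction t, hrt using Nat.le_induction with
  | base => exact ⟨E, hE, fun _ _ => rfl⟩
  | succ t hrt ih =>
    obtain ⟨E₁, h1, h2⟩ := ih (by omega)
    obtain ⟨E₂, h3, h4⟩ := h1.exists_succ (by omega)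
    exact ⟨E₂, h3, fun f hf => (h4 f (degLE_mono hrt hf)).trans (h2 f hf)⟩

/-- Evaluation at the nowhere defined map is a pseudo-expectation of degree `0`. -/
lemma isPseudoExp_zero :
    IsPseudoExp 0 (LinearMap.proj (R := F2) (φ := fun _ : P → Option H => F2) fun _ => none) where
  hole i j h _ f := by simp [pvar]
  pigeon i s hs := by omega

end PseudoExpectation

/-! ### Linear systems -/

section LinearSystems

/-- If a linear system implies a linear clause, a single linear equation interpolates. -/
lemma exists_interpolant [Fintype V] [DecidableEq V] (L : LinSystem V) (C : LinClause V)
    (h : ∀ σ, SysSat σ L → ClauseSat σ C) :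
    ∃ l : LinLit V, (∀ σ, SysSat σ L → LitSat σ l) ∧ ∀ σ, LitSat σ l → ClauseSat σ C := by
  let U : Submodule F2 (LinForm V × F2) := Submodule.span F2 (L : Set (LinLit V))
  let W : Submodule F2 (LinForm V × F2) :=
    Submodule.span F2 ((fun l : LinLit V => (l.1, l.2 + 1)) '' (C : Set (LinLit V)))
  have hspan : ∀ (σ : V → F2) (A : Set (LinLit V)), (∀ l ∈ A, LitSat σ l) →
      ∀ l ∈ Submodule.span F2 A, LitSat σ l := by
    intro σ A hA l hl
    induction hl using Submodule.span_induction with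
    | mem x hx => exact hA x hx
    | zero => simp [LitSat, evalForm]
    | add x y _ _ hx hy =>
      simp only [LitSat, evalForm, Prod.fst_add, Prod.snd_add, Pi.add_apply, add_mul,
        sum_add_distrib] at hx hy ⊢
      rw [hx, hy]
    | smul r x _ hx =>
      simp only [LitSat, evalForm, Prod.smul_fst, Prod.smul_snd, Pi.smul_apply, smul_eq_mul,
        mul_assoc, ← mul_sum] at hx ⊢
      rw [hx]
  have hF2 : ∀ x y : F2, x ≠ y → x = y + 1 := by decide
  have hmem : ((0, 1) : LinForm V × F2) ∈ U ⊔ W := by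
    by_contra hn
    obtain ⟨φ, hφ, hφ0⟩ := Submodule.exists_le_ker_of_notMem hn
    have hφ1 : φ (0, 1) = 1 := (show ∀ x : F2, x ≠ 0 → x = 1 by decide) _ hφ
    let σ : V → F2 := fun v => φ (Pi.single v 1, 0)
    have hσ : ∀ l : LinLit V, φ l = evalForm l.1 σ + l.2 := by
      intro l
      have h1 : l = ∑ v, l.1 v • ((Pi.single v 1, 0) : LinForm V × F2) + l.2 • (0, 1) := by
        ext v
        · simp [Prod.fst_sum, Finset.sum_apply, Pi.single_apply]
        · simp [Prod.snd_sum]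
      conv_lhs => rw [h1]
      rw [map_add, map_sum, map_smul, hφ1]
      simp only [map_smul, smul_eq_mul, mul_one, evalForm, σ]
    have hker : ∀ l ∈ U ⊔ W, LitSat σ l := fun l hl => by
      have := hφ0 hl
      rw [LinearMap.mem_ker, hσ] at this
      exact (show ∀ x y : F2, x + y = 0 → x = y by decide) _ _ this
    obtain ⟨l, hl, hl'⟩ := h σ fun l hl =>
      hker l (Submodule.mem_sup_left (Submodule.subset_span hl))
    have := hker (l.1, l.2 + 1)
      (Submodule.mem_sup_right (Submodule.subset_span ⟨l, hl, rfl⟩))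
    simp only [LitSat] at hl' this
    rw [hl'] at this
    simp at this
  obtain ⟨u, hu, w, hw, huw⟩ := Submodule.mem_sup.1 hmem
  refine ⟨u, fun σ hσ => hspan σ _ hσ u hu, fun σ hσ => ?_⟩
  by_contra hC
  have hw' : LitSat σ w := by
    refine hspan σ _ ?_ w hw
    rintro _ ⟨l, hl, rfl⟩
    exact hF2 _ _ fun hl' => hC ⟨l, hl, hl'⟩
  have : LitSat σ (u + w) := by
    simp only [LitSat, evalForm, Prod.fst_add, Prod.snd_add, Pi.add_apply, add_mul,
      sum_add_distrib] at hσ hw' ⊢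
    rw [hσ, hw']
  rw [huw] at this
  simp [LitSat, evalForm] at this

end LinearSystems

/-! ### Space of refutations -/

section Space

set_option linter.unusedSectionVars false

variable {P H : Type} [Fintype P] [DecidableEq P] [Fintype H] [DecidableEq H]

/-- The assignment corresponding to a partial map. -/
def toAssignment (b : P → Option H) : P × H → F2 := fun v => pvar v b

/-- The indicator of the solutions of a linear system among partial maps. -/
noncomputable def sysInd (L : LinSystem (P × H)) : (P → Option H) → F2 :=
  {b | SysSat (toAssignment b) L}.indicator 1

lemma sysInd_eq_one {L : LinSystem (P × H)} {b : P → Option H}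
    (h : SysSat (toAssignment b) L) : sysInd L b = 1 := Set.indicator_of_mem (by exact h) _

lemma sysInd_eq_zero {L : LinSystem (P × H)} {b : P → Option H}
    (h : ¬ SysSat (toAssignment b) L) : sysInd L b = 0 := Set.indicator_of_notMem (by exact h) _

lemma sysInd_empty : sysInd (∅ : LinSystem (P × H)) = 1 := by
  ext b
  exact sysInd_eq_one fun l hl => absurd hl (notMem_empty l)

lemma sysInd_insert (l : LinLit (P × H)) (L : LinSystem (P × H)) :
    sysInd (insert l L) = sysInd L * (∑ v, l.1 v • pvar v + (l.2 + 1) • 1) := by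
  ext b
  have hv : (∑ v, l.1 v • pvar v + (l.2 + 1) • (1 : (P → Option H) → F2)) b =
      evalForm l.1 (toAssignment b) + (l.2 + 1) := by
    simp [evalForm, toAssignment, Finset.sum_apply]
  have hins : SysSat (toAssignment b) (insert l L) ↔
      LitSat (toAssignment b) l ∧ SysSat (toAssignment b) L := by
    simp [SysSat]
  rw [Pi.mul_apply, hv]
  by_cases hL : SysSat (toAssignment b) L
  · rw [sysInd_eq_one hL, one_mul]
    by_cases hl : LitSat (toAssignment b) l
    · rw [sysInd_eq_one (hins.2 ⟨hl, hL⟩), show evalForm l.1 (toAssignment b) = l.2 from hl]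
      exact (show ∀ x : F2, 1 = x + (x + 1) by decide) _
    · rw [sysInd_eq_zero fun h => hl (hins.1 h).1]
      exact (show ∀ x y : F2, x ≠ y → 0 = x + (y + 1) by decide) _ _ hl
  · rw [sysInd_eq_zero hL, sysInd_eq_zero fun h => hL (hins.1 h).2, zero_mul]

lemma sum_single_smul_pvar (v : P × H) :
    ∑ w, (Pi.single v (1 : F2) : P × H → F2) w • pvar w = pvar v := by
  rw [sum_eq_single v] <;> simp +contextual

lemma sysInd_insert_posLit (v : P × H) (L : LinSystem (P × H)) :
    sysInd (insert (posLit v) L) = sysInd L * pvar v := by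
  rw [sysInd_insert]
  simp only [posLit, sum_single_smul_pvar, show (1 + 1 : F2) = 0 by decide, zero_smul, add_zero]

lemma sysInd_insert_negLit (v : P × H) (L : LinSystem (P × H)) :
    sysInd (insert (negLit v) L) = sysInd L * (pvar v + 1) := by
  rw [sysInd_insert]
  simp only [negLit, sum_single_smul_pvar, zero_add, one_smul]

lemma mul_sysInd_mem (L : LinSystem (P × H)) {s : ℕ} {f : (P → Option H) → F2}
    (hf : f ∈ degLE P H s) : f * sysInd L ∈ degLE P H (s + L.card) := by
  induction L using Finset.induction_on with
  | empty => simpa [sysInd_empty] using hf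
  | insert l L hl ih =>
    rw [card_insert_of_notMem hl, sysInd_insert, ← mul_assoc, mul_add, mul_sum, ← add_assoc]
    refine Submodule.add_mem _ (Submodule.sum_mem _ fun v _ => ?_) ?_
    · rw [mul_smul_comm]
      exact Submodule.smul_mem _ _ (mul_pvar_mem ih v)
    · rw [mul_smul_comm, mul_one]
      exact Submodule.smul_mem _ _ (degLE_mono (Nat.le_succ _) ih)

lemma sysInd_mem (L : LinSystem (P × H)) : sysInd L ∈ degLE P H L.card := by
  simpa using mul_sysInd_mem L (one_mem_degLE 0)

/-- A configuration is feasible if it is implied by a linear system with at most as many equations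
as there are clauses, which has nonzero pseudo-expectation. -/
def Feasible (M : Config (P × H)) : Prop :=
  ∃ (L : LinSystem (P × H)) (E : ((P → Option H) → F2) →ₗ[F2] F2), L.card ≤ M.card ∧
    IsPseudoExp M.card E ∧ E (sysInd L) ≠ 0 ∧ ∀ C ∈ M, ∀ σ, SysSat σ L → ClauseSat σ C

lemma feasible_empty : Feasible (∅ : Config (P × H)) :=
  ⟨∅, _, le_rfl, isPseudoExp_zero, by simp [sysInd_empty], by simp⟩

lemma feasible_of_implies {M : Config (P × H)} {L : LinSystem (P × H)} {t : ℕ}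
    {E : ((P → Option H) → F2) →ₗ[F2] F2} (hE : IsPseudoExp t E) (ht : L.card + M.card ≤ t)
    (hL : E (sysInd L) ≠ 0) (hM : ∀ C ∈ M, ∀ σ, SysSat σ L → ClauseSat σ C) : Feasible M := by
  choose! l hLl hlC using fun C hC => exists_interpolant L C (hM C hC)
  refine ⟨M.image l, E ∘ₗ LinearMap.mulRight F2 (sysInd L), card_image_le, ⟨?_, ?_⟩, ?_, ?_⟩
  · intro i j h hij f
    rw [LinearMap.comp_apply, LinearMap.mulRight_apply, mul_right_comm]
    exact hE.hole i j h hij _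
  · intro i s hs f hf
    rw [LinearMap.comp_apply, LinearMap.mulRight_apply, mul_right_comm]
    exact hE.pigeon i (s + L.card) (by omega) _ (mul_sysInd_mem L hf)
  · have : sysInd (M.image l) * sysInd L = sysInd L := by
      ext b
      by_cases hb : SysSat (toAssignment b) L
      · rw [Pi.mul_apply, sysInd_eq_one hb, sysInd_eq_one, one_mul]
        intro x hx
        obtain ⟨C, hC, rfl⟩ := mem_image.1 hx
        exact hLl C hC _ hb
      · rw [Pi.mul_apply, sysInd_eq_zero hb, mul_zero]
    rwa [LinearMap.comp_apply, LinearMap.mulRight_apply, this]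
  · exact fun C hC σ hσ => hlC C hC σ (hσ _ (mem_image_of_mem l hC))

lemma Feasible.exists_isPseudoExp {M : Config (P × H)} (h : Feasible M) {t : ℕ}
    (hMt : M.card ≤ t) (ht : 2 * t ≤ Fintype.card H + 1) :
    ∃ (L : LinSystem (P × H)) (E : ((P → Option H) → F2) →ₗ[F2] F2), L.card ≤ M.card ∧
      IsPseudoExp t E ∧ E (sysInd L) ≠ 0 ∧ ∀ C ∈ M, ∀ σ, SysSat σ L → ClauseSat σ C := by
  obtain ⟨L, E, h1, h2, h3, h4⟩ := h
  obtain ⟨E', h5, h6⟩ := h2.exists_extension hMt ht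
  exact ⟨L, E', h1, h5, by rwa [h6 _ (degLE_mono h1 (sysInd_mem L))], h4⟩

lemma Feasible.empty_notMem {M : Config (P × H)} (h : Feasible M) : ∅ ∉ M := by
  obtain ⟨L, E, -, -, hE, hM⟩ := h
  intro h0
  refine hE ?_
  have : sysInd L = 0 := by
    ext b
    refine sysInd_eq_zero fun hb => ?_
    obtain ⟨l, hl, -⟩ := hM ∅ h0 _ hb
    exact notMem_empty l hl
  rw [this, map_zero]

/-- Two negative literals whose conjunction has vanishing pseudo-expectation can be satisfied. -/
lemma exists_extension_negLit {E : ((P → Option H) → F2) →ₗ[F2] F2} {L : LinSystem (P × H)}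
    (hL : E (sysInd L) ≠ 0) {v w : P × H} (hvw : E (sysInd L * (pvar v * pvar w)) = 0) :
    ∃ L', L ⊆ L' ∧ L'.card ≤ L.card + 2 ∧ E (sysInd L') ≠ 0 ∧
      ∀ σ, SysSat σ L' → ClauseSat σ {negLit v, negLit w} := by
  by_cases hv : E (sysInd (insert (negLit v) L)) = 0
  · refine ⟨insert (negLit w) (insert (posLit v) L),
      (subset_insert _ _).trans (subset_insert _ _), ?_, ?_,
      fun σ hσ => ⟨negLit w, by simp, hσ _ (by simp)⟩⟩
    · exact (card_insert_le _ _).trans (Nat.succ_le_succ (card_insert_le _ _))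
    · rw [sysInd_insert_negLit, sysInd_insert_posLit, mul_add, mul_assoc, mul_one, map_add, hvw,
        zero_add]
      rw [sysInd_insert_negLit, mul_add, mul_one, map_add] at hv
      intro h
      rw [h, zero_add] at hv
      exact hL hv
  · exact ⟨insert (negLit v) L, subset_insert _ _, (card_insert_le _ _).trans (by omega), hv,
      fun σ hσ => ⟨negLit v, by simp, hσ _ (by simp)⟩⟩

variable {n : ℕ}

lemma exists_extension_of_mem_FPHPCNF {t : ℕ}
    {E : ((Fin (n + 1) → Option (Fin n)) → F2) →ₗ[F2] F2} (hE : IsPseudoExp t E)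
    {L : LinSystem (Fin (n + 1) × Fin n)} (ht : L.card + 1 ≤ t) (hL : E (sysInd L) ≠ 0)
    {C : LinClause (Fin (n + 1) × Fin n)} (hC : C ∈ FPHPCNF n) :
    ∃ L', L ⊆ L' ∧ L'.card ≤ L.card + 2 ∧ E (sysInd L') ≠ 0 ∧
      ∀ σ, SysSat σ L' → ClauseSat σ C := by
  rcases hC with (⟨i, rfl⟩ | ⟨i, i', k, hi, rfl⟩) | ⟨i, j, k, hjk, rfl⟩
  · have := hE.pigeon i _ ht _ (sysInd_mem L)
    rw [mul_sum, map_sum] at this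
    obtain ⟨h, -, hh⟩ := exists_ne_zero_of_sum_ne_zero (this.trans_ne hL)
    refine ⟨insert (posLit (i, h)) L, subset_insert _ _,
      (card_insert_le _ _).trans (by omega), by rwa [sysInd_insert_posLit],
      fun σ hσ => ⟨posLit (i, h), ?_, hσ _ (mem_insert_self _ _)⟩⟩
    exact mem_image_of_mem _ (mem_univ h)
  · exact exists_extension_negLit hL (hE.hole i i' k hi _)
  · refine exists_extension_negLit hL ?_
    have : (pvar (i, j) * pvar (i, k) : (Fin (n + 1) → Option (Fin n)) → F2) = 0 := by
      ext b
      by_cases hb : b i = some j <;> simp [pvar, hb, hjk]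
    rw [this, mul_zero, map_zero]

lemma InferSem.clauseSat {V : Type} [Fintype V] [DecidableEq V] {M : Config V}
    {C : LinClause V} (h : InferSem M C) {σ : V → F2} (hσ : ∀ D ∈ M, ClauseSat σ D) :
    ClauseSat σ C := by
  rcases h with ⟨f, A, B, hA, hB, rfl⟩ | ⟨D, hD, h⟩
  · obtain ⟨l, hl, hlσ⟩ := hσ _ hA
    obtain ⟨l', hl', hlσ'⟩ := hσ _ hB
    rcases mem_insert.1 hl with rfl | hl
    · rcases mem_insert.1 hl' with rfl | hl'
      · simp only [LitSat] at hlσ hlσ'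
        rw [hlσ] at hlσ'
        exact absurd hlσ' (by decide)
      · exact ⟨l', mem_union_right _ hl', hlσ'⟩
    · exact ⟨l, mem_union_left _ hl, hlσ⟩
  · exact h σ (hσ D hD)

/-- Feasibility is preserved by the steps of a refutation with small configurations. -/
lemma Feasible.step {M M' : Config (Fin (n + 1) × Fin n)} (hM : Feasible M)
    (h : ConfigStep (FPHPCNF n) InferSem M M') {s : ℕ} (hMs : M.card ≤ s) (hMs' : M'.card ≤ s)
    (hs : 4 * s + 3 ≤ n) : Feasible M' := by
  obtain ⟨L, E, hLM, hE, hL, hLC⟩ := hM.exists_isPseudoExp (t := 2 * s + 2) (by omega)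
    (by rw [Fintype.card_fin]; omega)
  cases h with
  | download hC =>
    obtain ⟨L', hLL', hcard, hL', hLC'⟩ :=
      exists_extension_of_mem_FPHPCNF hE (by omega) hL hC
    refine feasible_of_implies hE (by omega) hL' fun D hD σ hσ => ?_
    rcases mem_insert.1 hD with rfl | hD
    · exact hLC' σ hσ
    · exact hLC D hD σ fun l hl => hσ l (hLL' hl)
  | erase hC =>
    exact feasible_of_implies hE (by omega) hL fun D hD => hLC D (mem_of_mem_erase hD)
  | infer hC =>
    refine feasible_of_implies hE (by omega) hL fun D hD σ hσ => ?_
    rcases mem_insert.1 hD with rfl | hD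
    · exact hC.clauseSat fun D hD => hLC D hD σ hσ
    · exact hLC D hD σ hσ

lemma card_le_spaceOf {V : Type} {π : List (Config V)} {M : Config V} (hM : M ∈ π) :
    M.card ≤ spaceOf π := by
  induction π with
  | nil => simp at hM
  | cons N π ih =>
    rcases List.mem_cons.1 hM with rfl | hM
    · exact le_max_left _ _
    · exact (ih hM).trans (le_max_right _ _)

lemma le_of_isConfigRefutation {π : List (Config (Fin (n + 1) × Fin n))}
    (h : IsConfigRefutation (FPHPCNF n) InferSem π) : n ≤ 4 * spaceOf π + 2 := by
  by_contra! hn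
  obtain ⟨h0, hchain, M, hM, hM0⟩ := h
  have key : ∀ (l : List (Config (Fin (n + 1) × Fin n))), (∀ N ∈ l, N.card ≤ spaceOf π) →
      List.IsChain (ConfigStep (FPHPCNF n) InferSem) l → (∀ N, l.head? = some N → Feasible N) →
      ∀ N ∈ l, Feasible N := by
    intro l
    induction l with
    | nil => simp
    | cons A l ih =>
      intro hs hl hA N hN
      have hfA := hA A rfl
      rcases List.mem_cons.1 hN with rfl | hN
      · exact hfA
      · refine ih (fun B hB => hs B (List.mem_cons_of_mem _ hB)) hl.tail (fun B hB => ?_) N hN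
        exact hfA.step ((List.isChain_cons.1 hl).1 B hB) (hs A List.mem_cons_self)
          (hs B (List.mem_cons_of_mem _ (List.mem_of_mem_head? hB))) (by omega)
  refine (key π (fun N => card_le_spaceOf) hchain (fun N hN => ?_) M
    (List.mem_of_getLast? hM)).empty_notMem hM0
  rw [h0] at hN
  exact Option.some.inj hN ▸ feasible_empty

end Space

/-- There are `c > 0` and `N` such that for all `n ≥ N`, every
configuration-style Res(⊕) refutation of `FPHP_n^{n+1}` has space at least `c·n`. -/
theorem fphp_space_lower_bound :
    ∃ c : ℝ, 0 < c ∧ ∃ N : ℕ, ∀ n : ℕ, N ≤ n →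
      ∀ π : List (Config (Fin (n + 1) × Fin n)),
        IsConfigRefutation (FPHPCNF n) InferSem π → c * n ≤ (spaceOf π : ℝ) := by
  refine ⟨1 / 8, by norm_num, 4, fun n hn π hπ => ?_⟩
  have h1 : (n : ℝ) ≤ 4 * spaceOf π + 2 := by exact_mod_cast le_of_isConfigRefutation hπ
  have h2 : (4 : ℝ) ≤ n := by exact_mod_cast hn
  linarith
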